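/- arXiv:0812.0733 — 2 statements merged into one kernel-verified Lean document; each statement's English description precedes it below -/
import Mathlib

section
/- For an integer partition λ with |λ| ≤ n, the number of k-divisible noncrossing partitions of {1,...,kn} whose reduced type is λ equals (kn)!·(n − |λ|) / (n · m_λ · (kn − ℓ(λ))!), where m_λ = ∏_i m_i(λ)!. -/
/-- A set partition of `{0, …, n-1}` is noncrossing if there is no quadruple
`a < b < c < d` with `a, c` in one block and `b, d` in a different block. -/
def IsNoncrossing {n : ℕ} (P : Finpartition (Finset.univ : Finset (Fin n))) : Prop :=
  ¬ ∃ (a b c d : Fin n) (B B' : Finset (Fin n)), a < b ∧ b < c ∧ c < d ∧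
      B ∈ P.parts ∧ B' ∈ P.parts ∧ B ≠ B' ∧ a ∈ B ∧ c ∈ B ∧ b ∈ B' ∧ d ∈ B'

/-- `m_λ = ∏_i m_i(λ)!`, the product of factorials of multiplicities of parts. -/
def mfac (lam : Multiset ℕ) : ℕ := lam.toFinset.prod fun i => (lam.count i).factorial

section RootedPartitions

variable {α : Type*} [LinearOrder α]

/-- No quadruple `x < y < z < w` has `x, z ∈ D` and `y, w ∈ E`. -/
def NoCross (D E : Finset α) : Prop :=
  ∀ x ∈ D, ∀ y ∈ E, ∀ z ∈ D, ∀ w ∈ E, x < y → y < z → z < w → False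

/-- `B` together with `Q` is a noncrossing partition of `S`, and `B` is the block of `a`. -/
structure IsRooted (S : Finset α) (a : α) (B : Finset α) (Q : Finset (Finset α)) : Prop where
  mem_root : a ∈ B
  cover : ∀ x, x ∈ S ↔ x ∈ B ∨ ∃ D ∈ Q, x ∈ D
  nonempty : ∀ D ∈ Q, D.Nonempty
  disj_root : ∀ D ∈ Q, ∀ x ∈ B, x ∉ D
  disj : ∀ D ∈ Q, ∀ E ∈ Q, ∀ x ∈ D, x ∈ E → D = E
  nc_root : ∀ D ∈ Q, NoCross B D
  nc_root' : ∀ D ∈ Q, NoCross D B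
  nc : ∀ D ∈ Q, ∀ E ∈ Q, D ≠ E → NoCross D E

/-- `a < b` are the two smallest elements of `S`. -/
structure IsFirstTwo (S : Finset α) (a b : α) : Prop where
  lt : a < b
  mem : b ∈ S
  le : ∀ x ∈ S, x ≠ a → b ≤ x

namespace IsRooted

variable {S B : Finset α} {a b : α} {Q : Finset (Finset α)}

theorem card_eq (h : IsRooted S a B Q) : S.card = B.card + (Q.val.map Finset.card).sum := by
  have hS : S = B ∪ Q.biUnion id := by
    ext x
    simp [h.cover x]
  have hd : Disjoint B (Q.biUnion id) := by
    rw [Finset.disjoint_left]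
    intro x hx hx'
    obtain ⟨D, hD, hxD⟩ := Finset.mem_biUnion.1 hx'
    exact h.disj_root D hD x hx hxD
  rw [hS, Finset.card_union_of_disjoint hd, Finset.card_biUnion]
  · rfl
  · intro D hD E hE hne
    change Disjoint D E
    rw [Finset.disjoint_left]
    exact fun x hx hx' => hne (h.disj D hD E hE x hx hx')

theorem erase_root (h : IsRooted S a B Q) (hab : IsFirstTwo S a b) (hb : b ∈ B) :
    IsRooted (S.erase b) a (B.erase b) Q where
  mem_root := Finset.mem_erase.2 ⟨hab.lt.ne, h.mem_root⟩
  cover x := by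
    have := h.cover x
    have := h.disj_root
    simp only [Finset.mem_erase]
    grind
  nonempty := h.nonempty
  disj_root D hD x hx := h.disj_root D hD x (Finset.mem_of_mem_erase hx)
  disj := h.disj
  nc_root D hD x hx y hy z hz w hw :=
    h.nc_root D hD x (Finset.mem_of_mem_erase hx) y hy z (Finset.mem_of_mem_erase hz) w hw
  nc_root' D hD x hx y hy z hz w hw :=
    h.nc_root' D hD x hx y (Finset.mem_of_mem_erase hy) z hz w (Finset.mem_of_mem_erase hw)
  nc := h.nc

theorem not_mem_of_erase (h : IsRooted (S.erase b) a B Q) :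
    b ∉ B ∧ ∀ D ∈ Q, b ∉ D := by
  have := h.cover b
  simp only [Finset.mem_erase, ne_eq, not_true_eq_false, false_and, false_iff] at this
  grind

theorem lt_of_mem_of_erase (h : IsRooted (S.erase b) a B Q) (hab : IsFirstTwo S a b) :
    (∀ x ∈ B, x ≠ a → b < x) ∧ (∀ D ∈ Q, ∀ x ∈ D, b < x) := by
  have h1 : ∀ x ∈ S.erase b, x ≠ a → b < x := fun x hx hxa =>
    lt_of_le_of_ne (hab.le x (Finset.mem_of_mem_erase hx) hxa) (Finset.ne_of_mem_erase hx).symm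
  refine ⟨fun x hx => h1 x ((h.cover x).2 (Or.inl hx)), fun D hD x hx => ?_⟩
  refine h1 x ((h.cover x).2 (Or.inr ⟨D, hD, hx⟩)) ?_
  rintro rfl
  exact h.disj_root D hD _ h.mem_root hx

theorem insert_root (h : IsRooted (S.erase b) a B Q) (hab : IsFirstTwo S a b) :
    IsRooted S a (insert b B) Q where
  mem_root := Finset.mem_insert_of_mem h.mem_root
  cover x := by
    have := h.cover x
    have := hab.mem
    simp only [Finset.mem_erase, Finset.mem_insert] at *
    grind
  nonempty := h.nonempty
  disj_root D hD x hx := by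
    rcases Finset.mem_insert.1 hx with rfl | hx
    · exact h.not_mem_of_erase.2 D hD
    · exact h.disj_root D hD x hx
  disj := h.disj
  nc_root D hD x hx y hy z hz w hw hxy hyz hzw := by
    have hby := (h.lt_of_mem_of_erase hab).2 D hD y hy
    have hz' : z ∈ B := by
      rcases Finset.mem_insert.1 hz with rfl | hz
      · exact absurd hby hyz.not_gt
      · exact hz
    rcases Finset.mem_insert.1 hx with rfl | hx
    · exact h.nc_root D hD a h.mem_root y hy z hz' w hw (hab.lt.trans hxy) hyz hzw
    · exact h.nc_root D hD x hx y hy z hz' w hw hxy hyz hzw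
  nc_root' D hD x hx y hy z hz w hw hxy hyz hzw := by
    have hbx := (h.lt_of_mem_of_erase hab).2 D hD x hx
    rcases Finset.mem_insert.1 hy with rfl | hy
    · exact absurd hbx hxy.not_gt
    rcases Finset.mem_insert.1 hw with rfl | hw
    · exact absurd hbx (hxy.trans (hyz.trans hzw)).not_gt
    exact h.nc_root' D hD x hx y hy z hz w hw hxy hyz hzw
  nc := h.nc

theorem lt_of_mem (h : IsRooted S a B Q) (hab : IsFirstTwo S a b) {C : Finset α} (hC : C ∈ Q)
    (hb : b ∈ C) : ∀ x ∈ C, ∀ y ∈ B, y ≠ a → x < y := by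
  intro x hx y hy hya
  have hby : b < y := lt_of_le_of_ne (hab.le y ((h.cover y).2 (Or.inl hy)) hya)
    fun e => h.disj_root C hC y hy (e ▸ hb)
  by_contra! hyx
  have hne : y ≠ x := fun e => h.disj_root C hC y hy (e ▸ hx)
  exact h.nc_root C hC a h.mem_root b hb y hy x hx hab.lt hby (lt_of_le_of_ne hyx hne)

theorem ge_of_mem (h : IsRooted S a B Q) (hab : IsFirstTwo S a b) {D : Finset α} (hD : D ∈ Q) :
    ∀ x ∈ D, b ≤ x := fun x hx =>
  hab.le x ((h.cover x).2 (Or.inr ⟨D, hD, hx⟩)) fun e =>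
    h.disj_root D hD a h.mem_root (e ▸ hx)

theorem merge (h : IsRooted S a B Q) (hab : IsFirstTwo S a b) {C : Finset α} (hC : C ∈ Q)
    (hb : b ∈ C) : IsRooted (S.erase b) a ((B ∪ C).erase b) (Q.erase C) where
  mem_root := Finset.mem_erase.2 ⟨hab.lt.ne, Finset.mem_union_left _ h.mem_root⟩
  cover x := by
    have h1 := h.cover x
    have h2 := h.disj C hC
    simp only [Finset.mem_erase, Finset.mem_union]
    grind
  nonempty D hD := h.nonempty D (Finset.mem_of_mem_erase hD)
  disj_root D hD x hx hxD := by
    obtain ⟨hne, hD⟩ := Finset.mem_erase.1 hD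
    rcases Finset.mem_union.1 (Finset.mem_of_mem_erase hx) with hx | hx
    · exact h.disj_root D hD x hx hxD
    · exact hne (h.disj D hD C hC x hxD hx)
  disj D hD E hE := h.disj D (Finset.mem_of_mem_erase hD) E (Finset.mem_of_mem_erase hE)
  nc_root D hD x hx y hy z hz w hw hxy hyz hzw := by
    obtain ⟨hne, hD⟩ := Finset.mem_erase.1 hD
    obtain ⟨hxb, hx⟩ := Finset.mem_erase.1 hx
    obtain ⟨hzb, hz⟩ := Finset.mem_erase.1 hz
    have hby : b < y := lt_of_le_of_ne (h.ge_of_mem hab hD y hy)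
      fun e => hne (h.disj D hD C hC y hy (e ▸ hb))
    rcases Finset.mem_union.1 hz with hz | hz
    · exact h.nc_root D hD a h.mem_root y hy z hz w hw (hab.lt.trans hby) hyz hzw
    · exact h.nc C hC D hD hne.symm b hb y hy z hz w hw hby hyz hzw
  nc_root' D hD x hx y hy z hz w hw hxy hyz hzw := by
    obtain ⟨hne, hD⟩ := Finset.mem_erase.1 hD
    obtain ⟨hyb, hy⟩ := Finset.mem_erase.1 hy
    obtain ⟨hwb, hw⟩ := Finset.mem_erase.1 hw
    have hbx : b < x := lt_of_le_of_ne (h.ge_of_mem hab hD x hx)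
      fun e => hne (h.disj D hD C hC x hx (e ▸ hb))
    rcases Finset.mem_union.1 hy with hy | hy
    · rcases Finset.mem_union.1 hw with hw | hw
      · exact h.nc_root' D hD x hx y hy z hz w hw hxy hyz hzw
      · have := h.lt_of_mem hab hC hb w hw y hy (hab.lt.trans (hbx.trans hxy)).ne'
        exact absurd (hyz.trans hzw) this.not_gt
    · exact h.nc C hC D hD hne.symm b hb x hx y hy z hz hbx hxy hyz
  nc D hD E hE := h.nc D (Finset.mem_of_mem_erase hD) E (Finset.mem_of_mem_erase hE)

theorem split (h : IsRooted (S.erase b) a B Q) (hab : IsFirstTwo S a b) {X : Finset α}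
    (hX : X ⊆ B.erase a) (hlt : ∀ x ∈ X, ∀ y ∈ B.erase a, y ∉ X → x < y) :
    IsRooted S a (B \ X) (insert (insert b X) Q) := by
  obtain ⟨hbB, hbQ⟩ := h.not_mem_of_erase
  obtain ⟨hltB, hltQ⟩ := h.lt_of_mem_of_erase hab
  have hXB : ∀ x ∈ X, x ∈ B := fun x hx => Finset.mem_of_mem_erase (hX hx)
  have haX : a ∉ X := fun ha => Finset.ne_of_mem_erase (hX ha) rfl
  have hdisj : ∀ D ∈ Q, ∀ x ∈ insert b X, x ∉ D := by
    intro D hD x hx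
    rcases Finset.mem_insert.1 hx with rfl | hx
    · exact hbQ D hD
    · exact h.disj_root D hD x (hXB x hx)
  have nc1 : ∀ D ∈ Q, NoCross (insert b X) D := by
    intro D hD x hx y hy z hz w hw hxy hyz hzw
    have hby := hltQ D hD y hy
    have hz' : z ∈ B := by
      rcases Finset.mem_insert.1 hz with rfl | hz
      · exact absurd hby hyz.not_gt
      · exact hXB z hz
    exact h.nc_root D hD a h.mem_root y hy z hz' w hw (hab.lt.trans hby) hyz hzw
  have nc2 : ∀ D ∈ Q, NoCross D (insert b X) := by
    intro D hD x hx y hy z hz w hw hxy hyz hzw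
    have hbx := hltQ D hD x hx
    rcases Finset.mem_insert.1 hy with rfl | hy
    · exact absurd hbx hxy.not_gt
    rcases Finset.mem_insert.1 hw with rfl | hw
    · exact absurd hbx (hxy.trans (hyz.trans hzw)).not_gt
    exact h.nc_root' D hD x hx y (hXB y hy) z hz w (hXB w hw) hxy hyz hzw
  have hCB : ∀ x ∈ insert b X, ∀ y ∈ B \ X, y ≠ a → x < y := by
    intro x hx y hy hya
    obtain ⟨hyB, hyX⟩ := Finset.mem_sdiff.1 hy
    rcases Finset.mem_insert.1 hx with rfl | hx
    · exact hltB y hyB hya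
    · exact hlt x hx y (Finset.mem_erase.2 ⟨hya, hyB⟩) hyX
  have haC : ∀ x ∈ insert b X, a < x := by
    intro x hx
    rcases Finset.mem_insert.1 hx with rfl | hx
    · exact hab.lt
    · exact hab.lt.trans (hltB x (hXB x hx) fun e => haX (e ▸ hx))
  refine ⟨?_, ?_, ?_, ?_, ?_, ?_, ?_, ?_⟩
  · exact Finset.mem_sdiff.2 ⟨h.mem_root, haX⟩
  · intro x
    have h1 := h.cover x
    have h2 := hab.mem
    have h3 := hXB x
    simp only [Finset.mem_erase, Finset.mem_sdiff,
      Finset.mem_insert] at *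
    grind
  · intro D hD
    rcases Finset.mem_insert.1 hD with rfl | hD
    · exact Finset.insert_nonempty _ _
    · exact h.nonempty D hD
  · intro D hD x hx
    obtain ⟨hxB, hxX⟩ := Finset.mem_sdiff.1 hx
    rcases Finset.mem_insert.1 hD with rfl | hD
    · rw [Finset.mem_insert]
      rintro (rfl | hx')
      · exact hbB hxB
      · exact hxX hx'
    · exact h.disj_root D hD x hxB
  · intro D hD E hE x hxD hxE
    rcases Finset.mem_insert.1 hD with rfl | hD <;> rcases Finset.mem_insert.1 hE with rfl | hE
    · rfl
    · exact absurd hxE (hdisj E hE x hxD)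
    · exact absurd hxD (hdisj D hD x hxE)
    · exact h.disj D hD E hE x hxD hxE
  · intro D hD x hx y hy z hz w hw hxy hyz hzw
    rcases Finset.mem_insert.1 hD with rfl | hD
    · have hza : z ≠ a := ((haC y hy).trans hyz).ne'
      exact absurd hzw (hCB w hw z hz hza).not_gt
    · exact h.nc_root D hD x (Finset.mem_sdiff.1 hx).1 y hy z (Finset.mem_sdiff.1 hz).1 w hw
        hxy hyz hzw
  · intro D hD x hx y hy z hz w hw hxy hyz hzw
    rcases Finset.mem_insert.1 hD with rfl | hD
    · have hya : y ≠ a := ((haC x hx).trans hxy).ne'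
      exact absurd hyz (hCB z hz y hy hya).not_gt
    · exact h.nc_root' D hD x hx y (Finset.mem_sdiff.1 hy).1 z hz w (Finset.mem_sdiff.1 hw).1
        hxy hyz hzw
  · intro D hD E hE hne
    rcases Finset.mem_insert.1 hD with rfl | hD <;> rcases Finset.mem_insert.1 hE with rfl | hE
    · exact absurd rfl hne
    · exact nc1 E hE
    · exact nc2 D hD
    · exact h.nc D hD E hE hne

end IsRooted

theorem exists_initial_segment (A : Finset α) (t : ℕ) (ht : t ≤ A.card) :
    ∃ X ⊆ A, X.card = t ∧ ∀ x ∈ X, ∀ y ∈ A, y ∉ X → x < y := by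
  induction t with
  | zero => exact ⟨∅, by simp⟩
  | succ t ih =>
    obtain ⟨X, hXA, hXt, hX⟩ := ih (by omega)
    have hne : (A \ X).Nonempty := by
      rw [← Finset.card_pos, Finset.card_sdiff_of_subset hXA]
      omega
    have hm := Finset.min'_mem _ hne
    obtain ⟨hmA, hmX⟩ := Finset.mem_sdiff.1 hm
    refine ⟨insert ((A \ X).min' hne) X, Finset.insert_subset hmA hXA, ?_, ?_⟩
    · rw [Finset.card_insert_of_notMem hmX, hXt]
    · intro x hx y hy hyX
      rw [Finset.mem_insert, not_or] at hyX
      rcases Finset.mem_insert.1 hx with rfl | hx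
      · exact lt_of_le_of_ne (Finset.min'_le _ _ (Finset.mem_sdiff.2 ⟨hy, hyX.2⟩))
          (Ne.symm hyX.1)
      · exact hX x hx y hy hyX.2

theorem initial_segment_unique {A X Y : Finset α} (hXA : X ⊆ A) (hYA : Y ⊆ A)
    (hX : ∀ x ∈ X, ∀ y ∈ A, y ∉ X → x < y) (hY : ∀ x ∈ Y, ∀ y ∈ A, y ∉ Y → x < y)
    (hc : X.card = Y.card) : X = Y := by
  by_cases h : X ⊆ Y
  · exact Finset.eq_of_subset_of_card_le h hc.ge
  · obtain ⟨x, hxX, hxY⟩ := Finset.not_subset.1 h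
    refine (Finset.eq_of_subset_of_card_le (fun y hy => ?_) hc.le).symm
    by_contra hyX
    exact (hX x hxX y (hYA hy) hyX).not_gt (hY y hy x (hXA hxX) hxY)


/-- The block of `Q` containing `b`. -/
def blockOf (b : α) (Q : Finset (Finset α)) : Finset α := (Q.filter (b ∈ ·)).sup id

theorem blockOf_eq {b : α} {Q : Finset (Finset α)} {C : Finset α} (hC : C ∈ Q) (hb : b ∈ C)
    (huniq : ∀ D ∈ Q, b ∈ D → D = C) : blockOf b Q = C := by
  have : Q.filter (b ∈ ·) = {C} := by
    ext D
    simp only [Finset.mem_filter, Finset.mem_singleton]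
    grind
  simp [blockOf, this]

theorem IsRooted.blockOf_spec {S B : Finset α} {a b : α} {Q : Finset (Finset α)}
    (h : IsRooted S a B Q) (hbS : b ∈ S) (hb : b ∉ B) : blockOf b Q ∈ Q ∧ b ∈ blockOf b Q := by
  obtain hB | ⟨C, hC, hbC⟩ := (h.cover b).1 hbS
  · exact absurd hB hb
  · rw [blockOf_eq hC hbC fun D hD hbD => h.disj D hD C hC b hbD hbC]
    exact ⟨hC, hbC⟩

theorem merge_injective {S B₁ B₂ : Finset α} {a b : α} {Q₁ Q₂ : Finset (Finset α)}
    {C₁ C₂ : Finset α} (hab : IsFirstTwo S a b) (h₁ : IsRooted S a B₁ Q₁)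
    (h₂ : IsRooted S a B₂ Q₂) (hC₁ : C₁ ∈ Q₁) (hC₂ : C₂ ∈ Q₂) (hb₁ : b ∈ C₁) (hb₂ : b ∈ C₂)
    (hcard : C₁.card = C₂.card) (hB : (B₁ ∪ C₁).erase b = (B₂ ∪ C₂).erase b)
    (hQ : Q₁.erase C₁ = Q₂.erase C₂) : B₁ = B₂ ∧ Q₁ = Q₂ := by
  have sub : ∀ {B C : Finset α} {Q : Finset (Finset α)}, IsRooted S a B Q → C ∈ Q → b ∈ C →
      C.erase b ⊆ ((B ∪ C).erase b).erase a ∧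
        ∀ x ∈ C.erase b, ∀ y ∈ ((B ∪ C).erase b).erase a, y ∉ C.erase b → x < y := by
    intro B C Q h hC hb
    have haC := h.disj_root C hC a h.mem_root
    constructor
    · intro x hx
      simp only [Finset.mem_erase, Finset.mem_union] at hx ⊢
      exact ⟨fun e => haC (e ▸ hx.2), hx.1, Or.inr hx.2⟩
    · intro x hx y hy hyC
      simp only [Finset.mem_erase, Finset.mem_union] at hx hy hyC
      refine h.lt_of_mem hab hC hb x hx.2 y ?_ hy.1
      exact hy.2.2.resolve_right fun hyC' => hyC ⟨hy.2.1, hyC'⟩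
  obtain ⟨s₁, l₁⟩ := sub h₁ hC₁ hb₁
  obtain ⟨s₂, l₂⟩ := sub h₂ hC₂ hb₂
  rw [← hB] at s₂ l₂
  have hX : C₁.erase b = C₂.erase b := by
    refine initial_segment_unique s₁ s₂ l₁ l₂ ?_
    rw [Finset.card_erase_of_mem hb₁, Finset.card_erase_of_mem hb₂, hcard]
  have hC : C₁ = C₂ := by rw [← Finset.insert_erase hb₁, hX, Finset.insert_erase hb₂]
  subst hC
  refine ⟨?_, by rw [← Finset.insert_erase hC₁, hQ, Finset.insert_erase hC₂]⟩
  have key : ∀ {B : Finset α} {Q : Finset (Finset α)}, IsRooted S a B Q → C₁ ∈ Q →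
      B = (B ∪ C₁).erase b \ C₁ := by
    intro B Q h hC
    ext x
    have := h.disj_root C₁ hC x
    simp only [Finset.mem_sdiff, Finset.mem_erase, Finset.mem_union]
    grind
  rw [key h₁ hC₁, hB, ← key h₂ hC₂]

section Counting

variable [Fintype α]

open Classical in
/-- The noncrossing partitions of `S`, as pairs of the block of `a` and the set of other blocks,
in which the other blocks have multiset of sizes `μ`. -/
noncomputable def rootedSet (S : Finset α) (a : α) (μ : Multiset ℕ) :
    Finset (Finset α × Finset (Finset α)) :=
  Finset.univ.filter fun p => IsRooted S a p.1 p.2 ∧ p.2.val.map Finset.card = μ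

theorem mem_rootedSet {S : Finset α} {a : α} {μ : Multiset ℕ}
    {p : Finset α × Finset (Finset α)} :
    p ∈ rootedSet S a μ ↔ IsRooted S a p.1 p.2 ∧ p.2.val.map Finset.card = μ := by
  simp [rootedSet]

theorem card_rootedSet_filter_mem {S : Finset α} {a b : α} (hab : IsFirstTwo S a b)
    (μ : Multiset ℕ) :
    ((rootedSet S a μ).filter fun p => b ∈ p.1).card = (rootedSet (S.erase b) a μ).card := by
  refine Finset.card_nbij' (fun p => (p.1.erase b, p.2)) (fun p => (insert b p.1, p.2))
    ?_ ?_ ?_ ?_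
  · rintro ⟨B, Q⟩ hp
    simp only [Finset.coe_filter, Set.mem_ofPred_eq, mem_rootedSet, Finset.mem_coe] at hp ⊢
    exact ⟨hp.1.1.erase_root hab hp.2, hp.1.2⟩
  · rintro ⟨B, Q⟩ hp
    simp only [Finset.coe_filter, Set.mem_ofPred_eq, mem_rootedSet, Finset.mem_coe] at hp ⊢
    exact ⟨⟨hp.1.insert_root hab, hp.2⟩, Finset.mem_insert_self _ _⟩
  · rintro ⟨B, Q⟩ hp
    simp only [Finset.coe_filter, Set.mem_ofPred_eq] at hp
    simp [Finset.insert_erase hp.2]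
  · rintro ⟨B, Q⟩ hp
    simp only [mem_rootedSet, Finset.mem_coe] at hp
    simp [Finset.erase_insert hp.1.not_mem_of_erase.1]

theorem card_rootedSet_filter_blockOf {S : Finset α} {a b : α} (hab : IsFirstTwo S a b)
    {μ : Multiset ℕ} (hμ : μ.sum < S.card) {s : ℕ} (hs : s ∈ μ) (hs0 : 0 < s) :
    ((rootedSet S a μ).filter fun p => b ∉ p.1 ∧ (blockOf b p.2).card = s).card =
      (rootedSet (S.erase b) a (μ.erase s)).card := by
  refine Finset.card_nbij
    (fun p => ((p.1 ∪ blockOf b p.2).erase b, p.2.erase (blockOf b p.2))) ?_ ?_ ?_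
  · rintro ⟨B, Q⟩ hp
    simp only [Finset.coe_filter, Set.mem_ofPred_eq, mem_rootedSet, Finset.mem_coe] at hp ⊢
    obtain ⟨⟨h, hQ⟩, hbB, hc⟩ := hp
    obtain ⟨hC, hbC⟩ := h.blockOf_spec hab.mem hbB
    refine ⟨h.merge hab hC hbC, ?_⟩
    rw [Finset.erase_val, Multiset.map_erase_of_mem _ _ hC, hQ, hc]
  · rintro ⟨B₁, Q₁⟩ hp₁ ⟨B₂, Q₂⟩ hp₂ heq
    simp only [Finset.coe_filter, Set.mem_ofPred_eq, mem_rootedSet] at hp₁ hp₂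
    obtain ⟨⟨h₁, -⟩, hb₁, hc₁⟩ := hp₁
    obtain ⟨⟨h₂, -⟩, hb₂, hc₂⟩ := hp₂
    obtain ⟨hC₁, hbC₁⟩ := h₁.blockOf_spec hab.mem hb₁
    obtain ⟨hC₂, hbC₂⟩ := h₂.blockOf_spec hab.mem hb₂
    simp only [Prod.mk.injEq] at heq ⊢
    exact merge_injective hab h₁ h₂ hC₁ hC₂ hbC₁ hbC₂ (hc₁.trans hc₂.symm) heq.1 heq.2
  · rintro ⟨B, Q⟩ hp
    simp only [mem_rootedSet, Finset.mem_coe] at hp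
    obtain ⟨h, hQ⟩ := hp
    have hcard := h.card_eq
    have hsum : s + (μ.erase s).sum = μ.sum := by
      rw [← Multiset.sum_cons, Multiset.cons_erase hs]
    rw [hQ, Finset.card_erase_of_mem hab.mem] at hcard
    obtain ⟨X, hXB, hXs, hX⟩ := exists_initial_segment (B.erase a) (s - 1) (by
      rw [Finset.card_erase_of_mem h.mem_root]
      omega)
    have hR := h.split hab hXB hX
    obtain ⟨hbB, hbQ⟩ := h.not_mem_of_erase
    have hXB' : X ⊆ B := hXB.trans (Finset.erase_subset _ _)
    have hbX : b ∉ X := fun hx => hbB (hXB' hx)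
    have hnot : insert b X ∉ Q := fun hm => hbQ _ hm (Finset.mem_insert_self _ _)
    have hblock : blockOf b (insert (insert b X) Q) = insert b X := by
      refine blockOf_eq (Finset.mem_insert_self _ _) (Finset.mem_insert_self _ _) fun D hD hbD => ?_
      rcases Finset.mem_insert.1 hD with rfl | hD
      · rfl
      · exact absurd hbD (hbQ D hD)
    have hcardX : (insert b X).card = s := by
      rw [Finset.card_insert_of_notMem hbX, hXs]
      omega
    refine ⟨(B \ X, insert (insert b X) Q), ?_, ?_⟩
    · simp only [Finset.coe_filter, Set.mem_ofPred_eq, mem_rootedSet, hblock]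
      refine ⟨⟨hR, ?_⟩, fun hb => hbB (Finset.mem_sdiff.1 hb).1, hcardX⟩
      rw [Finset.insert_val_of_notMem hnot, Multiset.map_cons, hQ, hcardX, Multiset.cons_erase hs]
    · simp only [hblock, Finset.erase_insert hnot, Prod.mk.injEq, and_true]
      ext x
      have := @hXB' x
      simp only [Finset.mem_erase, Finset.mem_union, Finset.mem_sdiff, Finset.mem_insert]
      grind

theorem card_rootedSet_recurrence {S : Finset α} {a b : α} (hab : IsFirstTwo S a b)
    {μ : Multiset ℕ} (hμ : μ.sum < S.card) (hpos : ∀ i ∈ μ, 0 < i) :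
    (rootedSet S a μ).card = (rootedSet (S.erase b) a μ).card +
      ∑ s ∈ μ.toFinset, (rootedSet (S.erase b) a (μ.erase s)).card := by
  rw [← card_rootedSet_filter_mem hab,
    ← Finset.card_filter_add_card_filter_not (s := rootedSet S a μ) (fun p => b ∈ p.1)]
  congr 1
  rw [Finset.card_eq_sum_card_fiberwise (f := fun p => (blockOf b p.2).card) (t := μ.toFinset)]
  · refine Finset.sum_congr rfl fun s hs => ?_
    have hs := Multiset.mem_toFinset.1 hs
    rw [Finset.filter_filter, card_rootedSet_filter_blockOf hab hμ hs (hpos s hs)]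
  · rintro ⟨B, Q⟩ hp
    simp only [Finset.coe_filter, Set.mem_ofPred_eq, mem_rootedSet] at hp
    obtain ⟨⟨h, hQ⟩, hbB⟩ := hp
    rw [Finset.mem_coe, Multiset.mem_toFinset, ← hQ]
    exact Multiset.mem_map_of_mem _ (h.blockOf_spec hab.mem hbB).1

end Counting

theorem count_mul_mfac_erase {μ : Multiset ℕ} {s : ℕ} (hs : s ∈ μ) :
    μ.count s * mfac (μ.erase s) = mfac μ := by
  have hsub : (μ.erase s).toFinset ⊆ μ.toFinset :=
    Multiset.toFinset_subset.2 (Multiset.erase_subset _ _)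
  have h1 : mfac (μ.erase s) = ∏ i ∈ μ.toFinset, ((μ.erase s).count i).factorial := by
    refine Finset.prod_subset hsub fun i _ hi => ?_
    rw [Multiset.mem_toFinset] at hi
    simp [Multiset.count_eq_zero_of_notMem hi]
  have hs' := Multiset.mem_toFinset.2 hs
  rw [h1, mfac, ← Finset.mul_prod_erase _ _ hs', ← Finset.mul_prod_erase _ _ hs', ← mul_assoc,
    Multiset.count_erase_self, Nat.mul_factorial_pred (Multiset.count_pos.2 hs).ne']
  congr 1
  refine Finset.prod_congr rfl fun i hi => ?_
  rw [Multiset.count_erase_of_ne (Finset.ne_of_mem_erase hi)]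

theorem sum_toFinset_count_mul (μ : Multiset ℕ) (g : ℕ → ℕ) :
    ∑ s ∈ μ.toFinset, μ.count s * g s = (μ.map g).sum := by
  rw [Finset.sum_multiset_map_count]
  simp

theorem card_le_sum_of_pos {μ : Multiset ℕ} (hpos : ∀ i ∈ μ, 0 < i) :
    Multiset.card μ ≤ μ.sum := by
  have := Multiset.card_nsmul_le_sum (s := μ) (a := 1) hpos
  simpa using this

theorem exists_isFirstTwo {S : Finset α} {a : α} (ha : a ∈ S) (hmin : ∀ x ∈ S, a ≤ x)
    (hS : 1 < S.card) : ∃ b, IsFirstTwo S a b := by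
  have hne : (S.erase a).Nonempty := by
    rw [← Finset.card_pos, Finset.card_erase_of_mem ha]
    omega
  have hm := Finset.mem_erase.1 (Finset.min'_mem _ hne)
  exact ⟨(S.erase a).min' hne, lt_of_le_of_ne (hmin _ hm.2) hm.1.symm, hm.2,
    fun x hx hxa => Finset.min'_le _ _ (Finset.mem_erase.2 ⟨hxa, hx⟩)⟩

theorem card_rootedSet [Fintype α] (S : Finset α) (a : α) (ha : a ∈ S) (hmin : ∀ x ∈ S, a ≤ x)
    (μ : Multiset ℕ) (hpos : ∀ i ∈ μ, 0 < i) (hμ : μ.sum ≤ S.card) :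
    (rootedSet S a μ).card * (S.card * mfac μ * (S.card - Multiset.card μ).factorial) =
      S.card.factorial * (S.card - μ.sum) := by
  rcases hμ.eq_or_lt with hμ | hμ
  · have : rootedSet S a μ = ∅ := by
      rw [Finset.eq_empty_iff_forall_notMem]
      rintro ⟨B, Q⟩ hp
      obtain ⟨h, hQ⟩ : IsRooted S a B Q ∧ Q.val.map Finset.card = μ := mem_rootedSet.1 hp
      have hc := h.card_eq
      have hB : 0 < B.card := Finset.card_pos.2 ⟨a, h.mem_root⟩
      rw [hQ] at hc
      omega
    simp [this, hμ]
  have hl := card_le_sum_of_pos hpos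
  obtain hS | hS : S.card = 1 ∨ 1 < S.card := by omega
  · have hμ0 : μ = 0 := by
      rw [← Multiset.card_eq_zero]
      omega
    subst hμ0
    obtain ⟨c, rfl⟩ := Finset.card_eq_one.1 hS
    obtain rfl := Finset.mem_singleton.1 ha
    have : rootedSet {a} a 0 = {({a}, ∅)} := by
      ext ⟨B, Q⟩
      rw [mem_rootedSet, Finset.mem_singleton, Prod.mk.injEq]
      constructor
      · rintro ⟨h, hQ⟩
        have hQ' : Q = ∅ := by simpa using hQ
        subst hQ'
        refine ⟨?_, rfl⟩
        ext x
        simpa using (h.cover x).symm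
      · rintro ⟨rfl, rfl⟩
        refine ⟨⟨?_, ?_, ?_, ?_, ?_, ?_, ?_, ?_⟩, ?_⟩ <;> simp
    simp [this, mfac]
  · obtain ⟨b, hab⟩ := exists_isFirstTwo ha hmin hS
    have hcard : (S.erase b).card = S.card - 1 := Finset.card_erase_of_mem hab.mem
    have ha' : a ∈ S.erase b := Finset.mem_erase.2 ⟨hab.lt.ne, ha⟩
    have hmin' : ∀ x ∈ S.erase b, a ≤ x := fun x hx => hmin x (Finset.mem_of_mem_erase hx)
    have hlt : (S.erase b).card < S.card := by omega
    have ih0 := card_rootedSet (S.erase b) a ha' hmin' μ hpos (by omega)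
    have ih1 : ∀ s ∈ μ, (rootedSet (S.erase b) a (μ.erase s)).card *
        ((S.card - 1) * mfac (μ.erase s) * (S.card - Multiset.card μ).factorial) =
        (S.card - 1).factorial * (S.card - 1 - μ.sum + s) := by
      intro s hs
      have hsum : s + (μ.erase s).sum = μ.sum := by
        rw [← Multiset.sum_cons, Multiset.cons_erase hs]
      have hcl : Multiset.card (μ.erase s) + 1 = Multiset.card μ :=
        Multiset.card_erase_add_one hs
      have := card_rootedSet (S.erase b) a ha' hmin' (μ.erase s)
        (fun i hi => hpos i (Multiset.mem_of_mem_erase hi)) (by omega)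
      rw [hcard] at this
      rw [show S.card - Multiset.card μ = S.card - 1 - Multiset.card (μ.erase s) by omega, this]
      congr 1
      omega
    rw [card_rootedSet_recurrence hab hμ hpos]
    rw [hcard] at ih0
    obtain ⟨f, hf⟩ : ∃ f, S.card = μ.sum + f + 1 := ⟨S.card - μ.sum - 1, by omega⟩
    obtain ⟨r, hr⟩ : ∃ r, S.card = Multiset.card μ + r + 1 :=
      ⟨S.card - Multiset.card μ - 1, by omega⟩
    obtain ⟨M, hM⟩ : ∃ M, S.card = M + 2 := ⟨S.card - 2, by omega⟩
    rw [show S.card - 1 - Multiset.card μ = r by omega, show S.card - 1 - μ.sum = f by omega,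
      show S.card - 1 = M + 1 by omega] at ih0
    rw [show S.card - Multiset.card μ = r + 1 by omega, show S.card - μ.sum = f + 1 by omega, hM]
    have hsumF : (∑ s ∈ μ.toFinset, (rootedSet (S.erase b) a (μ.erase s)).card) * mfac μ *
        ((M + 1) * (r + 1).factorial) =
        (M + 1).factorial * (Multiset.card μ * f + μ.sum) := by
      have : ∀ s ∈ μ.toFinset, (rootedSet (S.erase b) a (μ.erase s)).card * mfac μ *
          ((M + 1) * (r + 1).factorial) = μ.count s * ((M + 1).factorial * (f + s)) := by
        intro s hs
        rw [Multiset.mem_toFinset] at hs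
        have h1 := ih1 s hs
        rw [show S.card - Multiset.card μ = r + 1 by omega,
          show S.card - 1 - μ.sum = f by omega, show S.card - 1 = M + 1 by omega] at h1
        rw [← count_mul_mfac_erase hs, ← h1]
        ring
      rw [Finset.sum_mul, Finset.sum_mul, Finset.sum_congr rfl this, sum_toFinset_count_mul,
        Multiset.sum_map_mul_left, Multiset.sum_map_add]
      simp
    have hrel : (r + 1) * f + (Multiset.card μ * f + μ.sum) = (M + 1) * (f + 1) := by
      have h1 : Multiset.card μ + r = M + 1 := by omega
      have h2 : μ.sum + f = M + 1 := by omega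
      calc _ = (Multiset.card μ + r) * f + (μ.sum + f) := by ring
        _ = _ := by rw [h1, h2]; ring
    apply Nat.eq_of_mul_eq_mul_left (Nat.succ_pos M)
    rw [Nat.succ_eq_add_one]
    calc _ = (M + 2) * ((r + 1) * ((rootedSet (S.erase b) a μ).card *
            ((M + 1) * mfac μ * r.factorial)) +
          (∑ s ∈ μ.toFinset, (rootedSet (S.erase b) a (μ.erase s)).card) * mfac μ *
            ((M + 1) * (r + 1).factorial)) := by
          rw [Nat.factorial_succ r]
          ring
      _ = (M + 2) * (M + 1).factorial * ((r + 1) * f + (Multiset.card μ * f + μ.sum)) := by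
          rw [ih0, hsumF]
          ring
      _ = _ := by
          rw [hrel, Nat.factorial_succ (M + 1)]
          ring
termination_by S.card

end RootedPartitions

theorem mfac_map {f : ℕ → ℕ} (hf : Function.Injective f) (μ : Multiset ℕ) :
    mfac (μ.map f) = mfac μ := by
  rw [mfac, mfac, Multiset.toFinset_map, Finset.prod_image fun _ _ _ _ h => hf h]
  refine Finset.prod_congr rfl fun i _ => ?_
  rw [Multiset.count_map_eq_count' f μ hf]

theorem isRooted_of_isNoncrossing {N : ℕ} {P : Finpartition (Finset.univ : Finset (Fin N))}
    (hP : IsNoncrossing P) (a : Fin N) :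
    IsRooted Finset.univ a (P.part a) (P.parts.erase (P.part a)) := by
  have hroot : P.part a ∈ P.parts := P.part_mem.2 (Finset.mem_univ a)
  have hnc : ∀ D ∈ P.parts, ∀ E ∈ P.parts, D ≠ E → NoCross D E := by
    intro D hD E hE hne x hx y hy z hz w hw hxy hyz hzw
    exact hP ⟨x, y, z, w, D, E, hxy, hyz, hzw, hD, hE, hne, hx, hz, hy, hw⟩
  have hdisj : ∀ D ∈ P.parts, ∀ E ∈ P.parts, ∀ x ∈ D, x ∈ E → D = E :=
    fun D hD E hE x hx hx' => P.eq_of_mem_parts hD hE hx hx'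
  refine ⟨P.mem_part (Finset.mem_univ a), fun x => ?_, fun D hD => ?_, fun D hD x hx hxD => ?_,
    fun D hD E hE => ?_, fun D hD => ?_, fun D hD => ?_, fun D hD E hE => ?_⟩
  · refine ⟨fun _ => ?_, fun _ => Finset.mem_univ x⟩
    by_cases h : P.part x = P.part a
    · exact Or.inl (h ▸ P.mem_part (Finset.mem_univ x))
    · exact Or.inr ⟨P.part x, Finset.mem_erase.2 ⟨h, P.part_mem.2 (Finset.mem_univ x)⟩,
        P.mem_part (Finset.mem_univ x)⟩
  · exact P.nonempty_of_mem_parts (Finset.mem_of_mem_erase hD)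
  · obtain ⟨hne, hD⟩ := Finset.mem_erase.1 hD
    exact hne (hdisj D hD _ hroot x hxD hx)
  · exact hdisj D (Finset.mem_of_mem_erase hD) E (Finset.mem_of_mem_erase hE)
  · obtain ⟨hne, hD⟩ := Finset.mem_erase.1 hD
    exact hnc _ hroot D hD hne.symm
  · obtain ⟨hne, hD⟩ := Finset.mem_erase.1 hD
    exact hnc D hD _ hroot hne
  · exact hnc D (Finset.mem_of_mem_erase hD) E (Finset.mem_of_mem_erase hE)

theorem exists_isNoncrossing_of_isRooted {N : ℕ} {a : Fin N} {B : Finset (Fin N)}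
    {Q : Finset (Finset (Fin N))} (h : IsRooted Finset.univ a B Q) :
    ∃ P : Finpartition (Finset.univ : Finset (Fin N)), IsNoncrossing P ∧ P.part a = B ∧
      P.parts.erase B = Q := by
  have hBQ : B ∉ Q := fun hB => h.disj_root B hB a h.mem_root h.mem_root
  have hdisj : ∀ D ∈ insert B Q, ∀ E ∈ insert B Q, ∀ x ∈ D, x ∈ E → D = E := by
    intro D hD E hE x hx hx'
    rcases Finset.mem_insert.1 hD with hD | hD <;> rcases Finset.mem_insert.1 hE with hE | hE
    · rw [hD, hE]
    · exact absurd hx' (h.disj_root E hE x (hD ▸ hx))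
    · exact absurd hx (h.disj_root D hD x (hE ▸ hx'))
    · exact h.disj D hD E hE x hx hx'
  have hempty : ∅ ∉ insert B Q := by
    rw [Finset.mem_insert, not_or]
    refine ⟨fun e => ?_, fun he => ?_⟩
    · exact Finset.notMem_empty a (e ▸ h.mem_root)
    · exact Finset.not_nonempty_empty (h.nonempty _ he)
  let P : Finpartition (Finset.univ : Finset (Fin N)) :=
    { parts := insert B Q
      supIndep := by
        rw [Finset.supIndep_iff_pairwiseDisjoint]
        intro D hD E hE hne
        exact Finset.disjoint_left.2 fun x hx hx' => hne (hdisj D hD E hE x hx hx')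
      sup_parts := by
        ext x
        have := (h.cover x).1 (Finset.mem_univ x)
        simpa [Finset.mem_sup] using this
      bot_notMem := hempty }
  have hpart : P.part a = B := P.part_eq_of_mem (Finset.mem_insert_self _ _) h.mem_root
  refine ⟨P, ?_, hpart, Finset.erase_insert hBQ⟩
  rintro ⟨x, y, z, w, D, E, hxy, hyz, hzw, hD, hE, hne, hx, hz, hy, hw⟩
  have hDQ : D = B ∨ D ∈ Q := Finset.mem_insert.1 hD
  have hEQ : E = B ∨ E ∈ Q := Finset.mem_insert.1 hE
  rcases hDQ with rfl | hDQ <;> rcases hEQ with rfl | hEQ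
  · exact hne rfl
  · exact h.nc_root E hEQ x hx y hy z hz w hw hxy hyz hzw
  · exact h.nc_root' D hDQ x hx y hy z hz w hw hxy hyz hzw
  · exact h.nc D hDQ E hEQ hne x hx y hy z hz w hw hxy hyz hzw

theorem dvd_and_map_div_eq_iff {β : Type*} {k : ℕ} (hk : 0 < k) (μ : Multiset β) (g : β → ℕ)
    (lam : Multiset ℕ) :
    ((∀ B ∈ μ, k ∣ g B) ∧ μ.map (fun B => g B / k) = lam) ↔ μ.map g = lam.map (k * ·) := by
  constructor
  · rintro ⟨hd, rfl⟩
    rw [Multiset.map_map]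
    exact Multiset.map_congr rfl fun B hB => (Nat.mul_div_cancel' (hd B hB)).symm
  · intro h
    constructor
    · intro B hB
      have := Multiset.mem_map_of_mem g hB
      rw [h] at this
      obtain ⟨i, -, hi⟩ := Multiset.mem_map.1 this
      exact ⟨i, hi.symm⟩
    · calc μ.map (fun B => g B / k) = (μ.map g).map (· / k) := by
            rw [Multiset.map_map]
            rfl
        _ = lam := by
            rw [h, Multiset.map_map]
            simp [Nat.mul_div_cancel_left _ hk]

theorem ncard_eq_card_rootedSet (k n : ℕ) (hk : 0 < k) (a : Fin (k * n)) (lam : Multiset ℕ) :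
    {P : Finpartition (Finset.univ : Finset (Fin (k * n))) |
        IsNoncrossing P ∧ (∀ B ∈ P.parts, k ∣ B.card) ∧
          (P.parts.erase (P.part a)).val.map (fun B => B.card / k) = lam}.ncard =
      (rootedSet Finset.univ a (lam.map (k * ·))).card := by
  rw [← Set.ncard_coe_finset]
  refine Set.ncard_congr (fun P _ => (P.part a, P.parts.erase (P.part a))) ?_ ?_ ?_
  · rintro P ⟨hP, hd, hlam⟩
    rw [Finset.mem_coe, mem_rootedSet]
    exact ⟨isRooted_of_isNoncrossing hP a,
      (dvd_and_map_div_eq_iff hk _ _ _).1 ⟨fun B hB => hd B (Finset.mem_of_mem_erase hB), hlam⟩⟩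
  · intro P P' _ _ heq
    simp only [Prod.mk.injEq] at heq
    obtain ⟨h1, h2⟩ := heq
    ext1
    rw [← Finset.insert_erase (P.part_mem.2 (Finset.mem_univ a)), h2, h1,
      Finset.insert_erase (P'.part_mem.2 (Finset.mem_univ a))]
  · rintro ⟨B, Q⟩ hp
    simp only [Finset.mem_coe, mem_rootedSet] at hp
    obtain ⟨h, hQ⟩ := hp
    obtain ⟨P, hP, rfl, rfl⟩ := exists_isNoncrossing_of_isRooted h
    obtain ⟨hd, hlam⟩ := (dvd_and_map_div_eq_iff hk _ _ _).2 hQ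
    refine ⟨P, ⟨hP, fun B hB => ?_, hlam⟩, rfl⟩
    by_cases hB' : B = P.part a
    · have hc := h.card_eq
      rw [hQ, Multiset.sum_map_mul_left, Multiset.map_id', Finset.card_univ,
        Fintype.card_fin] at hc
      rw [hB']
      exact (Nat.dvd_add_left (Dvd.intro _ rfl)).1 (hc ▸ Dvd.intro _ rfl)
    · exact hd B (Finset.mem_erase.2 ⟨hB', hB⟩)

/-- The number of `k`-divisible noncrossing partitions of `{1, …, kn}` whose reduced type
(type after deleting the block containing the symbol `1`) is `λ`, with `|λ| ≤ n`, equals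
`(kn)!·(n-|λ|) / (n·m_λ·(kn-ℓ(λ))!)`. -/
theorem stmt_7 (k n : ℕ) (hk : 0 < k) (hn : 0 < n) (lam : Multiset ℕ)
    (hsum : lam.sum ≤ n) (hpos : ∀ i ∈ lam, 0 < i) :
    {P : Finpartition (Finset.univ : Finset (Fin (k * n))) |
        IsNoncrossing P ∧ (∀ B ∈ P.parts, k ∣ B.card) ∧
          (P.parts.erase (P.part ⟨0, Nat.mul_pos hk hn⟩)).val.map (fun B => B.card / k) =
            lam}.ncard =
      (k * n).factorial * (n - lam.sum) /
        (n * mfac lam * (k * n - Multiset.card lam).factorial) := by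
  have hpos' : ∀ i ∈ lam.map (k * ·), 0 < i := by
    intro i hi
    obtain ⟨j, hj, rfl⟩ := Multiset.mem_map.1 hi
    exact Nat.mul_pos hk (hpos j hj)
  have hsum' : (lam.map (k * ·)).sum = k * lam.sum := by
    rw [Multiset.sum_map_mul_left, Multiset.map_id']
  have hinj : Function.Injective (k * ·) := fun x y h => Nat.eq_of_mul_eq_mul_left hk h
  have key := card_rootedSet Finset.univ (⟨0, Nat.mul_pos hk hn⟩ : Fin (k * n))
    (Finset.mem_univ _) (fun x _ => Nat.zero_le x.val) _ hpos' (by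
      rw [hsum', Finset.card_univ, Fintype.card_fin]
      exact Nat.mul_le_mul_left k hsum)
  rw [hsum', mfac_map hinj, Multiset.card_map, Finset.card_univ, Fintype.card_fin,
    ← Nat.mul_sub] at key
  rw [ncard_eq_card_rootedSet k n hk]
  symm
  apply Nat.div_eq_of_eq_mul_left
  · have : 0 < mfac lam := Finset.prod_pos fun i _ => Nat.factorial_pos _
    positivity
  · apply Nat.eq_of_mul_eq_mul_left hk
    linarith
end

section
/- There is a type- and reduced-type-preserving bijection between k-Fuss-Catalan paths of length n and k-divisible noncrossing partitions of {1,...,kn}. -/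
/-- The multiset of lengths of maximal runs of `true` (east steps) in a list of steps. -/
def trueRuns (p : List Bool) : Multiset ℕ :=
  ↑(((p.splitBy (· == ·)).filter fun g => g.any id).map List.length)

theorem trueRuns_append {l m : List Bool}
    (h : ∀ x ∈ l.getLast?, ∀ y ∈ m.head?, x ≠ y) :
    trueRuns (l ++ m) = trueRuns l + trueRuns m := by
  rw [trueRuns, List.splitBy_append (by simpa using h)]
  simp [trueRuns]

theorem trueRuns_replicate_false (c : ℕ) : trueRuns (List.replicate c false) = 0 := by
  rcases c with _ | c
  · simp [trueRuns]
  · have h : (List.replicate (c + 1) false).IsChain (fun x y => x == y) := by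
      simp [List.isChain_replicate_of_rel]
    rw [trueRuns, List.splitBy_of_isChain (by simp) h]
    simp

theorem trueRuns_replicate_true {c : ℕ} (hc : c ≠ 0) :
    trueRuns (List.replicate c true) = {c} := by
  have h : (List.replicate c true).IsChain (fun x y => x == y) := by
    simp [List.isChain_replicate_of_rel]
  rw [trueRuns, List.splitBy_of_isChain (by simpa using hc) h]
  simp [hc]

theorem trueRuns_false_cons (l : List Bool) : trueRuns (false :: l) = trueRuns l := by
  obtain ⟨c, m, rfl, hm⟩ : ∃ c m, l = List.replicate c false ++ m ∧
      ∀ b ∈ m.head?, b = true := by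
    induction l with
    | nil => exact ⟨0, [], by simp⟩
    | cons b l ih =>
      cases b
      · obtain ⟨c, m, rfl, hm⟩ := ih
        exact ⟨c + 1, m, by simp [List.replicate_succ], hm⟩
      · exact ⟨0, true :: l, by simp⟩
  have key (c : ℕ) : trueRuns (List.replicate c false ++ m) = trueRuns m := by
    rw [trueRuns_append (fun x hx y hy => by grind), trueRuns_replicate_false, zero_add]
  rw [key, ← List.cons_append, ← List.replicate_succ, key]

theorem trueRuns_replicate_true_append (c : ℕ) (l : List Bool) :
    trueRuns (List.replicate c true ++ false :: l) = ({c} : Multiset ℕ).filter (· ≠ 0) +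
      trueRuns l := by
  rcases eq_or_ne c 0 with rfl | hc
  · simp [trueRuns_false_cons]
  · rw [trueRuns_append (by simp [List.getLast?_replicate]), trueRuns_replicate_true hc,
      trueRuns_false_cons, Multiset.filter_singleton, if_pos hc]

/-- The lattice path with `a[j]` east steps immediately before its `j`-th north step. -/
def pathOfHeights (a : List ℕ) : List Bool :=
  a.flatMap fun m => List.replicate m true ++ [false]

theorem pathOfHeights_cons (m : ℕ) (a : List ℕ) :
    pathOfHeights (m :: a) = List.replicate m true ++ false :: pathOfHeights a := by
  simp [pathOfHeights]

theorem pathOfHeights_append (a b : List ℕ) :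
    pathOfHeights (a ++ b) = pathOfHeights a ++ pathOfHeights b := by
  simp [pathOfHeights]

theorem trueRuns_pathOfHeights (a : List ℕ) :
    trueRuns (pathOfHeights a) = (a : Multiset ℕ).filter (· ≠ 0) := by
  induction a with
  | nil => simp [pathOfHeights, trueRuns]
  | cons m a ih =>
    rw [pathOfHeights_cons, trueRuns_replicate_true_append, ih, ← Multiset.filter_add,
      Multiset.singleton_add, Multiset.cons_coe]

theorem trueRuns_dropWhile_pathOfHeights (m : ℕ) (a : List ℕ) :
    trueRuns ((pathOfHeights (m :: a)).dropWhile (· == true)) =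
      (a : Multiset ℕ).filter (· ≠ 0) := by
  rw [pathOfHeights_cons, List.dropWhile_append_of_pos (by simp),
    List.dropWhile_cons_of_neg (by simp), trueRuns_false_cons, trueRuns_pathOfHeights]

theorem count_true_pathOfHeights (a : List ℕ) : (pathOfHeights a).count true = a.sum := by
  induction a with
  | nil => simp [pathOfHeights]
  | cons m a ih => simp [pathOfHeights_cons, ih]

theorem count_false_pathOfHeights (a : List ℕ) : (pathOfHeights a).count false = a.length := by
  induction a with
  | nil => simp [pathOfHeights]
  | cons m a ih => simp [pathOfHeights_cons, ih, List.count_replicate]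

theorem exists_eq_pathOfHeights_append (p : List Bool) :
    ∃ a t, p = pathOfHeights a ++ List.replicate t true := by
  induction p with
  | nil => exact ⟨[], 0, by simp [pathOfHeights]⟩
  | cons b p ih =>
    obtain ⟨a, t, rfl⟩ := ih
    cases b
    · exact ⟨0 :: a, t, by simp [pathOfHeights_cons]⟩
    · cases a with
      | nil => exact ⟨[], t + 1, by simp [pathOfHeights, List.replicate_succ]⟩
      | cons m a => exact ⟨(m + 1) :: a, t, by simp [pathOfHeights_cons, List.replicate_succ]⟩

theorem replicate_true_append_false_cons_inj {m m' : ℕ} {l l' : List Bool}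
    (h : List.replicate m true ++ false :: l = List.replicate m' true ++ false :: l') :
    m = m' ∧ l = l' := by
  induction m generalizing m' with
  | zero => cases m' <;> simp_all [List.replicate_succ]
  | succ m ih =>
    cases m' with
    | zero => simp [List.replicate_succ] at h
    | succ m' =>
      obtain ⟨rfl, rfl⟩ := ih (by simpa [List.replicate_succ] using h)
      simp

theorem prefix_of_pathOfHeights_append_eq {a b : List ℕ} {u : List Bool}
    (h : pathOfHeights b ++ u = pathOfHeights a) : b <+: a := by
  induction b generalizing a with
  | nil => simp
  | cons m b ih =>
    cases a with
    | nil => simp [pathOfHeights] at h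
    | cons m' a =>
      rw [pathOfHeights_cons, pathOfHeights_cons, List.append_assoc, List.cons_append] at h
      obtain ⟨rfl, h'⟩ := replicate_true_append_false_cons_inj h
      exact List.cons_prefix_cons.2 ⟨rfl, ih h'⟩

theorem pathOfHeights_injective : Function.Injective pathOfHeights := fun a b h =>
  have hl : a.length = b.length := by
    rw [← count_false_pathOfHeights, h, count_false_pathOfHeights]
  (prefix_of_pathOfHeights_append_eq (u := []) (by simpa using h)).eq_of_length hl

theorem forall_prefix_pathOfHeights_iff (k : ℕ) (a : List ℕ) :
    (∀ q : List Bool, q <+: pathOfHeights a → q.count false ≤ k * q.count true) ↔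
      ∀ j < a.length, j + 1 ≤ k * (a.take (j + 1)).sum := by
  constructor
  · intro h j hj
    have := h (pathOfHeights (a.take (j + 1)))
      ⟨pathOfHeights (a.drop (j + 1)), by rw [← pathOfHeights_append, List.take_append_drop]⟩
    rw [count_false_pathOfHeights, count_true_pathOfHeights, List.length_take] at this
    omega
  · rintro h q ⟨u, hu⟩
    obtain ⟨b, t, rfl⟩ := exists_eq_pathOfHeights_append q
    have hb : b <+: a := prefix_of_pathOfHeights_append_eq ((List.append_assoc ..).symm.trans hu)
    have hle := hb.length_le
    rw [List.prefix_iff_eq_take] at hb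
    rw [List.count_append, List.count_append, count_false_pathOfHeights, count_true_pathOfHeights]
    simp only [List.count_replicate, beq_self_eq_true, if_true, mul_add]
    rcases hlen : b.length with _ | j
    · simp
    · have := h j (by omega)
      rw [← hlen, ← hb] at this
      simp
      omega

theorem isFussCatalanPath_iff {k n : ℕ} (hk : 0 < k) (p : List Bool) :
    (p.count true = n ∧ p.count false = k * n ∧
      ∀ q : List Bool, q <+: p → q.count false ≤ k * q.count true) ↔
    ∃ f : Fin (k * n) → ℕ, p = pathOfHeights (List.ofFn f) ∧ ∑ i, f i = n ∧
      ∀ j : Fin (k * n), (j : ℕ) + 1 ≤ k * ∑ i ∈ Finset.Iic j, f i := by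
  have htake {N : ℕ} (f : Fin N → ℕ) (j : Fin N) :
      ((List.ofFn f).take (j + 1)).sum = ∑ i ∈ Finset.Iic j, f i := by
    rw [List.sum_take_ofFn]
    refine Finset.sum_congr (Finset.ext fun i => ?_) fun _ _ => rfl
    rw [Finset.mem_filter_univ, Finset.mem_Iic, Fin.le_iff_val_le_val, Nat.lt_succ_iff]
  constructor
  · rintro ⟨ht, hf, hq⟩
    obtain ⟨a, t, rfl⟩ := exists_eq_pathOfHeights_append p
    have h0 := hq _ (List.prefix_append _ _)
    simp only [List.count_append, count_false_pathOfHeights, count_true_pathOfHeights,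
      List.count_replicate] at ht hf h0
    simp at ht hf
    obtain rfl : t = 0 := by
      rw [hf] at h0
      have := Nat.le_of_mul_le_mul_left h0 hk
      omega
    simp only [List.replicate_zero, List.append_nil, add_zero] at hq ht ⊢
    rw [forall_prefix_pathOfHeights_iff] at hq
    have hex {N : ℕ} (h : a.length = N) : ∃ f : Fin N → ℕ, a = List.ofFn f := by
      subst h
      exact ⟨a.get, (List.ofFn_get a).symm⟩
    obtain ⟨f, rfl⟩ := hex hf
    refine ⟨f, rfl, by rwa [List.sum_ofFn] at ht, fun j => ?_⟩
    rw [← htake]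
    exact hq j (by simp)
  · rintro ⟨f, rfl, hs, hj⟩
    rw [count_true_pathOfHeights, count_false_pathOfHeights, forall_prefix_pathOfHeights_iff,
      List.sum_ofFn]
    refine ⟨hs, by simp, fun j hjn => ?_⟩
    rw [List.length_ofFn] at hjn
    exact (hj ⟨j, hjn⟩).trans_eq (by rw [← htake])

/-- A map sending each element to the least element of its block in some noncrossing partition. -/
structure IsNoncrossingRep {N : ℕ} (r : Fin N → Fin N) : Prop where
  le_self : ∀ x, r x ≤ x
  idem : ∀ x, r (r x) = r x
  noncrossing : ∀ x y, r y ≤ x → x ≤ y → r y ≤ r x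

/-- The number of elements sent to `x` by `r`. -/
def fiberCard {N : ℕ} (r : Fin N → Fin N) (x : Fin N) : ℕ :=
  (Finset.univ.filter fun y => r y = x).card

theorem sum_fiberCard {N : ℕ} (r : Fin N → Fin N) : ∑ x, fiberCard r x = N := by
  simpa [fiberCard] using (Finset.card_eq_sum_card_fiberwise (f := r) (s := Finset.univ)
    (t := Finset.univ) (by simp)).symm

namespace IsNoncrossingRep

variable {N : ℕ} {r r' : Fin N → Fin N}

theorem succ_le_sum_fiberCard (hr : IsNoncrossingRep r) (j : Fin N) :
    (j : ℕ) + 1 ≤ ∑ x ∈ Finset.Iic j, fiberCard r x := by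
  rw [← Fin.card_Iic, Finset.card_eq_sum_card_fiberwise (f := r) (t := Finset.Iic j)]
  · exact Finset.sum_le_sum fun x _ =>
      Finset.card_le_card (Finset.filter_subset_filter _ (Finset.subset_univ _))
  · intro x hx
    simp only [Finset.coe_Iic, Set.mem_Iic] at hx ⊢
    exact (hr.le_self x).trans hx

theorem le_of_fiberCard_eq (hr : IsNoncrossingRep r) (hr' : IsNoncrossingRep r')
    (h : fiberCard r = fiberCard r') {y : Fin N} (ih : ∀ x < y, r x = r' x) : r y ≤ r' y := by
  obtain ⟨z, hyz, hz⟩ : ∃ z, y ≤ z ∧ r' z = r y := by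
    by_contra! hc
    have hlt : fiberCard r' (r y) < fiberCard r (r y) := by
      refine Finset.card_lt_card (Finset.ssubset_iff_of_subset ?_ |>.2 ⟨y, ?_, ?_⟩)
      · intro x hx
        simp only [Finset.mem_filter_univ] at hx ⊢
        rw [ih x (not_le.1 fun hyx => hc x hyx hx), hx]
      · simp
      · simpa using hc y le_rfl
    exact hlt.ne (by rw [h])
  rw [← hz]
  exact hr'.noncrossing y z (hz.trans_le (hr.le_self y)) hyz

theorem ext_of_fiberCard_eq (hr : IsNoncrossingRep r) (hr' : IsNoncrossingRep r')
    (h : fiberCard r = fiberCard r') : r = r' := by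
  funext y
  induction y using WellFoundedLT.induction with
  | ind y ih =>
    exact (hr.le_of_fiberCard_eq hr' h ih).antisymm
      (hr'.le_of_fiberCard_eq hr h.symm fun x hx => (ih x hx).symm)

end IsNoncrossingRep

open Classical in
/-- Send `y` to the largest `x ≤ y` whose fibre below `y` has fewer than `s x` elements. -/
noncomputable def greedyRep {N : ℕ} (s : Fin N → ℕ) (y : Fin N) : Fin N :=
  let t := (Finset.Iic y).filter fun x =>
    ((Finset.univ : Finset (Set.Iio y)).filter fun i => greedyRep s i.1 = x).card < s x
  if h : t.Nonempty then t.max' h else y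
termination_by y
decreasing_by all_goals exact (‹Set.Iio y›).2

theorem exists_isNoncrossingRep {N : ℕ} (s : Fin N → ℕ) (hs : ∑ x, s x = N)
    (hj : ∀ j : Fin N, (j : ℕ) + 1 ≤ ∑ x ∈ Finset.Iic j, s x) :
    ∃ r : Fin N → Fin N, IsNoncrossingRep r ∧ fiberCard r = s := by
  classical
  set r := greedyRep s with hr
  let c (y x : Fin N) : ℕ := ((Finset.Iio y).filter fun i => r i = x).card
  let t (y : Fin N) : Finset (Fin N) := (Finset.Iic y).filter fun x => c y x < s x
  have hrt (y : Fin N) : r y = if h : (t y).Nonempty then (t y).max' h else y := by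
    have ht : t y = (Finset.Iic y).filter fun x =>
        ((Finset.univ : Finset (Set.Iio y)).filter fun i => greedyRep s i.1 = x).card < s x := by
      refine Finset.filter_congr fun x _ => ?_
      have : c y x = ((Finset.univ : Finset (Set.Iio y)).filter
          fun i => greedyRep s i.1 = x).card := by
        refine (Finset.card_bij (fun i _ => i.1) ?_ ?_ ?_).symm
        · rintro ⟨i, hi⟩ h
          simpa [hr, Set.mem_Iio.1 hi] using h
        · rintro ⟨i, hi⟩ _ ⟨i', hi'⟩ _ h
          simp_all
        · intro i hi
          simp only [Finset.mem_filter, Finset.mem_Iio] at hi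
          exact ⟨⟨i, hi.1⟩, by simpa using hi.2, rfl⟩
      rw [this]
    simp only [ht]
    rw [hr, greedyRep]
  have hle (y : Fin N) : r y ≤ y := by
    rw [hrt]
    split_ifs with h
    · exact Finset.mem_Iic.1 (Finset.mem_filter.1 ((t y).max'_mem h)).1
    · exact le_rfl
  have hne (y : Fin N) : (t y).Nonempty := by
    by_contra h
    have hc : ∀ x ∈ Finset.Iic y, s x ≤ c y x := by
      intro x hx
      by_contra hlt
      exact h ⟨x, Finset.mem_filter.2 ⟨hx, not_le.1 hlt⟩⟩
    have h1 := Finset.sum_le_sum hc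
    have h2 : (Finset.Iio y).card = ∑ x ∈ Finset.Iic y, c y x :=
      Finset.card_eq_sum_card_fiberwise fun i hi => by
        simp only [Finset.coe_Iio, Set.mem_Iio, Finset.coe_Iic, Set.mem_Iic] at hi ⊢
        exact (hle i).trans hi.le
    have h3 := hj y
    rw [Fin.card_Iio] at h2
    omega
  have hmem (y : Fin N) : c y (r y) < s (r y) := by
    rw [hrt, dif_pos (hne y)]
    exact (Finset.mem_filter.1 ((t y).max'_mem (hne y))).2
  have hmax {x y : Fin N} (hxy : x ≤ y) (h : c y x < s x) : x ≤ r y := by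
    rw [hrt y, dif_pos (hne y)]
    exact (t y).le_max' x (Finset.mem_filter.2 ⟨Finset.mem_Iic.2 hxy, h⟩)
  refine ⟨r, ⟨hle, fun x => (hle _).antisymm (hmax le_rfl ?_), fun x y hyx hxy =>
    hmax hyx (lt_of_le_of_lt ?_ (hmem y))⟩, ?_⟩
  · have : c (r x) (r x) = 0 := by
      refine Finset.card_eq_zero.2 (Finset.filter_eq_empty_iff.2 fun i hi => ?_)
      exact ((hle i).trans_lt (Finset.mem_Iio.1 hi)).ne
    exact this ▸ (Nat.zero_le _).trans_lt (hmem x)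
  · exact Finset.card_le_card (Finset.filter_subset_filter _ (Finset.Iio_subset_Iio hxy))
  · have hfib (x : Fin N) : fiberCard r x ≤ s x := by
      rcases (Finset.univ.filter fun y => r y = x).eq_empty_or_nonempty with h | h
      · simp [fiberCard, h]
      · obtain ⟨m, hm, hlast⟩ := (Finset.univ.filter fun y => r y = x).exists_maximal h
        rw [Finset.mem_filter_univ] at hm
        have hsub : (Finset.univ.filter fun y => r y = x) ⊆
            insert m ((Finset.Iio m).filter fun i => r i = x) := by
          intro i hi
          have hmi : m ≤ i → i ≤ m := hlast hi
          rw [Finset.mem_filter_univ] at hi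
          rcases lt_or_ge i m with h | h
          · simp [h, hi]
          · simp [le_antisymm h (hmi h)]
        have := (Finset.card_le_card hsub).trans (Finset.card_insert_le _ _)
        have hcm : c m x < s x := hm ▸ hmem m
        exact this.trans hcm
    funext x
    exact (Finset.sum_eq_sum_iff_of_le fun x _ => hfib x).1
      ((sum_fiberCard r).trans hs.symm) x (Finset.mem_univ x)

section Finpartition

variable {N : ℕ} (P : Finpartition (Finset.univ : Finset (Fin N)))

/-- The least element of the block of `x`. -/
def blockMin (x : Fin N) : Fin N :=
  (P.part x).min' ⟨x, P.mem_part_self.2 (Finset.mem_univ x)⟩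

theorem blockMin_mem (x : Fin N) : blockMin P x ∈ P.part x :=
  Finset.min'_mem _ _

theorem blockMin_le {x y : Fin N} (h : y ∈ P.part x) : blockMin P x ≤ y :=
  Finset.min'_le _ _ h

theorem part_eq_part_iff {x y : Fin N} : P.part x = P.part y ↔ blockMin P x = blockMin P y := by
  refine ⟨fun h => by simp only [blockMin, h], fun h => ?_⟩
  have hx := blockMin_mem P x
  rw [P.mem_part_iff_part_eq_part (Finset.mem_univ _) (Finset.mem_univ _)] at hx
  have hy := blockMin_mem P y
  rw [P.mem_part_iff_part_eq_part (Finset.mem_univ _) (Finset.mem_univ _)] at hy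
  rw [← hx, ← hy, h]

theorem mem_part_iff_blockMin {x y : Fin N} : y ∈ P.part x ↔ blockMin P y = blockMin P x := by
  rw [P.mem_part_iff_part_eq_part (Finset.mem_univ _) (Finset.mem_univ _), part_eq_part_iff]

theorem blockMin_blockMin (x : Fin N) : blockMin P (blockMin P x) = blockMin P x :=
  (mem_part_iff_blockMin P).1 (blockMin_mem P x)

theorem parts_eq_image_part :
    P.parts = (Finset.univ.filter fun x => blockMin P x = x).image P.part := by
  ext B
  simp only [Finset.mem_image, Finset.mem_filter_univ]
  constructor
  · intro hB
    obtain ⟨x, hx⟩ := P.nonempty_of_mem_parts hB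
    refine ⟨blockMin P x, blockMin_blockMin P x, ?_⟩
    rw [(part_eq_part_iff P).2 (blockMin_blockMin P x), P.part_eq_of_mem hB hx]
  · rintro ⟨x, -, rfl⟩
    exact P.part_mem.2 (Finset.mem_univ x)

theorem blockMin_injective :
    Function.Injective (blockMin : Finpartition (Finset.univ : Finset (Fin N)) → _) := by
  intro P Q h
  ext1
  have hpart : P.part = Q.part := by
    funext x
    ext y
    rw [mem_part_iff_blockMin, mem_part_iff_blockMin, h]
  rw [parts_eq_image_part, parts_eq_image_part Q, h, hpart]

theorem card_part_of_blockMin_eq_self {x : Fin N} (hx : blockMin P x = x) :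
    (P.part x).card = fiberCard (blockMin P) x := by
  rw [fiberCard]
  congr 1
  ext y
  rw [mem_part_iff_blockMin, hx, Finset.mem_filter_univ]

theorem fiberCard_blockMin_eq_zero {x : Fin N} (hx : blockMin P x ≠ x) :
    fiberCard (blockMin P) x = 0 := by
  refine Finset.card_eq_zero.2 (Finset.filter_eq_empty_iff.2 fun y _ h => hx ?_)
  rw [← h, blockMin_blockMin]

theorem fiberCard_blockMin_pos {x : Fin N} (hx : blockMin P x = x) :
    0 < fiberCard (blockMin P) x :=
  Finset.card_pos.2 ⟨x, by simpa using hx⟩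

theorem isNoncrossing_iff : IsNoncrossing P ↔ IsNoncrossingRep (blockMin P) := by
  have hself (x : Fin N) : blockMin P x ≤ x :=
    blockMin_le P (P.mem_part_self.2 (Finset.mem_univ x))
  constructor
  · refine fun h => ⟨hself, blockMin_blockMin P, fun x y hyx hxy => ?_⟩
    by_contra! hlt
    have hne : P.part x ≠ P.part y := fun he => hlt.ne ((part_eq_part_iff P).1 he)
    refine h ⟨blockMin P x, blockMin P y, x, y, P.part x, P.part y, hlt,
      hyx.lt_of_ne ?_, hxy.lt_of_ne ?_, P.part_mem.2 (Finset.mem_univ x),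
      P.part_mem.2 (Finset.mem_univ y), hne, blockMin_mem P x,
      P.mem_part_self.2 (Finset.mem_univ x), blockMin_mem P y,
      P.mem_part_self.2 (Finset.mem_univ y)⟩
    · rintro rfl
      exact hlt.ne (blockMin_blockMin P y)
    · rintro rfl
      exact hne rfl
  · rintro hr ⟨a, b, c, d, B, B', hab, hbc, hcd, hB, hB', hne, ha, hc, hb, hd⟩
    have hac := (part_eq_part_iff P).1
      ((P.part_eq_of_mem hB ha).trans (P.part_eq_of_mem hB hc).symm)
    have hbd := (part_eq_part_iff P).1
      ((P.part_eq_of_mem hB' hb).trans (P.part_eq_of_mem hB' hd).symm)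
    have h1 := hr.noncrossing c d (hbd ▸ (hself b).trans hbc.le) hcd.le
    have h2 := hr.noncrossing b c (hac ▸ (hself a).trans hab.le) hbc.le
    refine hne ?_
    rw [← P.part_eq_of_mem hB hc, ← P.part_eq_of_mem hB' hb, part_eq_part_iff]
    exact h2.antisymm (hbd ▸ h1)

theorem exists_blockMin_eq {r : Fin N → Fin N} (hr : IsNoncrossingRep r) :
    ∃ P : Finpartition (Finset.univ : Finset (Fin N)), blockMin P = r := by
  classical
  refine ⟨Finpartition.ofSetoid (Setoid.ker r), funext fun x => ?_⟩
  have hmem {x y : Fin N} : y ∈ (Finpartition.ofSetoid (Setoid.ker r)).part x ↔ r x = r y :=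
    Finpartition.mem_part_ofSetoid_iff_rel
  refine le_antisymm (blockMin_le _ (hmem.2 (hr.idem x).symm)) ?_
  rw [hmem.1 (blockMin_mem _ x)]
  exact hr.le_self _

theorem forall_parts_dvd_card_iff (k : ℕ) :
    (∀ B ∈ P.parts, k ∣ B.card) ↔ ∀ x, k ∣ fiberCard (blockMin P) x := by
  constructor
  · intro h x
    by_cases hx : blockMin P x = x
    · exact card_part_of_blockMin_eq_self P hx ▸ h _ (P.part_mem.2 (Finset.mem_univ x))
    · simp [fiberCard_blockMin_eq_zero P hx]
  · intro h B hB
    rw [parts_eq_image_part, Finset.mem_image] at hB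
    obtain ⟨x, hx, rfl⟩ := hB
    rw [card_part_of_blockMin_eq_self P (by simpa using hx)]
    exact h x

theorem map_card_div_parts {k : ℕ} (hk : 0 < k) (hP : ∀ B ∈ P.parts, k ∣ B.card) :
    P.parts.val.map (fun B => B.card / k) =
      (List.ofFn fun x => fiberCard (blockMin P) x / k : Multiset ℕ).filter (· ≠ 0) := by
  have hinj : Set.InjOn P.part ↑(Finset.univ.filter fun x => blockMin P x = x) := by
    intro x hx y hy h
    simp only [Finset.coe_filter, Finset.mem_univ, true_and, Set.mem_ofPred_eq] at hx hy
    rw [← hx, ← hy, (part_eq_part_iff P).1 h]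
  have hofFn (f : Fin N → ℕ) :
      ((List.ofFn f : List ℕ) : Multiset ℕ) = (Finset.univ : Finset (Fin N)).val.map f := by
    rw [List.ofFn_eq_map, Fin.univ_val_map, List.ofFn_eq_map]
  rw [parts_eq_image_part, Finset.image_val_of_injOn hinj, Multiset.map_map, hofFn,
    Multiset.filter_map, Finset.filter_val]
  have hfilter : (Finset.univ : Finset (Fin N)).val.filter (fun x => blockMin P x = x) =
      (Finset.univ : Finset (Fin N)).val.filter
        ((· ≠ 0) ∘ fun x => fiberCard (blockMin P) x / k) := by
    refine Multiset.filter_congr fun x _ => ?_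
    by_cases hx : blockMin P x = x
    · have := Nat.div_pos (Nat.le_of_dvd (fiberCard_blockMin_pos P hx)
        ((forall_parts_dvd_card_iff P k).1 hP x)) hk
      simp only [hx, Function.comp_apply, true_iff]
      exact this.ne'
    · simp [hx, fiberCard_blockMin_eq_zero P hx]
  rw [← hfilter]
  refine Multiset.map_congr rfl fun x hx => ?_
  rw [Function.comp_apply, card_part_of_blockMin_eq_self P (Multiset.mem_filter.1 hx).2]

end Finpartition

/-- The lattice path with `|B| / k` east steps right before the north step indexed by the least
element of each block `B`. -/
def pathOfPartition (k : ℕ) {N : ℕ} (P : Finpartition (Finset.univ : Finset (Fin N))) :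
    List Bool :=
  pathOfHeights (List.ofFn fun x => fiberCard (blockMin P) x / k)

theorem trueRuns_pathOfPartition {k N : ℕ} (hk : 0 < k)
    {P : Finpartition (Finset.univ : Finset (Fin N))} (hP : ∀ B ∈ P.parts, k ∣ B.card) :
    trueRuns (pathOfPartition k P) = P.parts.val.map (fun B => B.card / k) := by
  rw [pathOfPartition, trueRuns_pathOfHeights, map_card_div_parts P hk hP]

theorem trueRuns_dropWhile_pathOfPartition {k N : ℕ} (hk : 0 < k) (hN : 0 < N)
    {P : Finpartition (Finset.univ : Finset (Fin N))} (hP : ∀ B ∈ P.parts, k ∣ B.card) :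
    trueRuns ((pathOfPartition k P).dropWhile (· == true)) =
      (P.parts.erase (P.part ⟨0, hN⟩)).val.map (fun B => B.card / k) := by
  obtain ⟨M, rfl⟩ : ∃ M, N = M + 1 := ⟨N - 1, by omega⟩
  have hmin : blockMin P ⟨0, hN⟩ = ⟨0, hN⟩ :=
    le_antisymm (blockMin_le P (P.mem_part_self.2 (Finset.mem_univ _))) (Fin.zero_le _)
  have hpos : fiberCard (blockMin P) 0 / k ≠ 0 :=
    (Nat.div_pos (Nat.le_of_dvd (fiberCard_blockMin_pos P hmin)
      ((forall_parts_dvd_card_iff P k).1 hP _)) hk).ne'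
  rw [Finset.erase_val, Multiset.map_erase_of_mem _ _ (P.part_mem.2 (Finset.mem_univ _)),
    map_card_div_parts P hk hP, card_part_of_blockMin_eq_self P hmin, pathOfPartition,
    List.ofFn_succ, trueRuns_dropWhile_pathOfHeights, ← Multiset.cons_coe,
    Multiset.filter_cons_of_pos (p := (· ≠ 0)) _ hpos]
  exact (Multiset.erase_cons_head _ _).symm

theorem pathOfPartition_isFussCatalanPath {k n : ℕ} (hk : 0 < k)
    {P : Finpartition (Finset.univ : Finset (Fin (k * n)))} (hP : IsNoncrossing P)
    (hdvd : ∀ B ∈ P.parts, k ∣ B.card) :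
    (pathOfPartition k P).count true = n ∧ (pathOfPartition k P).count false = k * n ∧
      ∀ q : List Bool, q <+: pathOfPartition k P → q.count false ≤ k * q.count true := by
  rw [forall_parts_dvd_card_iff] at hdvd
  refine (isFussCatalanPath_iff hk _).2 ⟨_, rfl, ?_, fun j => ?_⟩
  · refine Nat.eq_of_mul_eq_mul_left hk ?_
    simp only [Finset.mul_sum, Nat.mul_div_cancel' (hdvd _), sum_fiberCard]
  · simp only [Finset.mul_sum, Nat.mul_div_cancel' (hdvd _)]
    exact ((isNoncrossing_iff P).1 hP).succ_le_sum_fiberCard j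

theorem pathOfPartition_inj {k N : ℕ} {P Q : Finpartition (Finset.univ : Finset (Fin N))}
    (hP : IsNoncrossing P) (hPk : ∀ B ∈ P.parts, k ∣ B.card)
    (hQ : IsNoncrossing Q) (hQk : ∀ B ∈ Q.parts, k ∣ B.card)
    (h : pathOfPartition k P = pathOfPartition k Q) : P = Q := by
  rw [forall_parts_dvd_card_iff] at hPk hQk
  refine blockMin_injective (((isNoncrossing_iff P).1 hP).ext_of_fiberCard_eq
    ((isNoncrossing_iff Q).1 hQ) (funext fun x => ?_))
  have hx := congrFun (List.ofFn_injective (pathOfHeights_injective h)) x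
  rw [← Nat.mul_div_cancel' (hPk x), ← Nat.mul_div_cancel' (hQk x), hx]

theorem exists_pathOfPartition_eq {k n : ℕ} (hk : 0 < k) {p : List Bool}
    (hp : p.count true = n ∧ p.count false = k * n ∧
      ∀ q : List Bool, q <+: p → q.count false ≤ k * q.count true) :
    ∃ P : Finpartition (Finset.univ : Finset (Fin (k * n))),
      (IsNoncrossing P ∧ ∀ B ∈ P.parts, k ∣ B.card) ∧ pathOfPartition k P = p := by
  obtain ⟨f, rfl, hs, hj⟩ := (isFussCatalanPath_iff hk p).1 hp
  obtain ⟨r, hr, hrf⟩ := exists_isNoncrossingRep (fun x => k * f x)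
    (by rw [← Finset.mul_sum, hs]) (fun j => by rw [← Finset.mul_sum]; exact hj j)
  obtain ⟨P, rfl⟩ := exists_blockMin_eq hr
  refine ⟨P, ⟨(isNoncrossing_iff P).2 hr, (forall_parts_dvd_card_iff P k).2 fun x => ?_⟩, ?_⟩
  · rw [hrf]
    exact dvd_mul_right _ _
  · simp only [pathOfPartition, hrf, Nat.mul_div_cancel_left _ hk]

/-- There is a bijection between `k`-Fuss–Catalan paths of length `n` and `k`-divisible
noncrossing partitions of `{1, …, kn}` preserving both type (ascent lengths ↔ block sizes
divided by `k`) and reduced type (ignoring the ascent containing the first step ↔ deleting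
the block containing the symbol `1`). -/
theorem stmt_10 (k n : ℕ) (hk : 0 < k) (hn : 0 < n) :
    ∃ e : {p : List Bool // p.count true = n ∧ p.count false = k * n ∧
            ∀ q : List Bool, q <+: p → q.count false ≤ k * q.count true} ≃
          {P : Finpartition (Finset.univ : Finset (Fin (k * n))) //
            IsNoncrossing P ∧ ∀ B ∈ P.parts, k ∣ B.card},
      ∀ p, trueRuns p.1 = (e p).1.parts.val.map (fun B => B.card / k) ∧
        trueRuns (p.1.dropWhile (· == true)) =
          ((e p).1.parts.erase ((e p).1.part ⟨0, Nat.mul_pos hk hn⟩)).val.map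
            (fun B => B.card / k) := by
  let F : {P : Finpartition (Finset.univ : Finset (Fin (k * n))) //
      IsNoncrossing P ∧ ∀ B ∈ P.parts, k ∣ B.card} →
      {p : List Bool // p.count true = n ∧ p.count false = k * n ∧
        ∀ q : List Bool, q <+: p → q.count false ≤ k * q.count true} :=
    fun P => ⟨pathOfPartition k P.1, pathOfPartition_isFussCatalanPath hk P.2.1 P.2.2⟩
  have hF : Function.Bijective F := by
    constructor
    · intro P Q h
      exact Subtype.ext (pathOfPartition_inj P.2.1 P.2.2 Q.2.1 Q.2.2 (congrArg Subtype.val h))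
    · rintro ⟨p, hp⟩
      obtain ⟨P, hP, hPp⟩ := exists_pathOfPartition_eq hk hp
      exact ⟨⟨P, hP⟩, Subtype.ext hPp⟩
  let e := Equiv.ofBijective F hF
  refine ⟨e.symm, fun p => ?_⟩
  obtain ⟨P, rfl⟩ := e.surjective p
  rw [e.symm_apply_apply]
  exact ⟨trueRuns_pathOfPartition hk P.2.2,
    trueRuns_dropWhile_pathOfPartition hk (Nat.mul_pos hk hn) P.2.2⟩
end
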